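/- arXiv:1106.5960 — 5 statements merged into one kernel-verified Lean document; each statement's English description precedes it below -/
import Mathlib

section
/- Let C be a binary self-dual code of length n with an automorphism σ of odd prime order p of type p-(c,f), with cycles Ω_1,…,Ω_c and fixed points Ω_{c+1},…,Ω_{c+f}. Let F_σ(C) = {v ∈ C : vσ = v} and E_σ(C) = {v ∈ C : wt(v|Ω_i) ≡ 0 (mod 2) for all i = 1,…,c+f}. Then C is the (internal) direct sum of the subcodes F_σ(C) and E_σ(C), and these subcodes have dimensions (c+f)/2 and c(p−1)/2 over F_2, respectively. -/
namespace SD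

variable {ι : Type*}

/-- The (Hamming) weight of a binary vector. -/
def wt [Fintype ι] (v : ι → ZMod 2) : ℕ := (Finset.univ.filter fun i => v i ≠ 0).card

/-- A binary code (subspace of `F_2^ι`) is self-dual if it coincides with its dual
under the standard inner product. -/
def isSelfDual [Fintype ι] (Code : Submodule (ZMod 2) (ι → ZMod 2)) : Prop :=
  ∀ u : ι → ZMod 2, u ∈ Code ↔ ∀ v ∈ Code, ∑ i, u i * v i = 0

/-- The linear map permuting coordinates of vectors by `σ`. -/
def permLM (σ : Equiv.Perm ι) : (ι → ZMod 2) →ₗ[ZMod 2] (ι → ZMod 2) where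
  toFun v := v ∘ σ
  map_add' _ _ := rfl
  map_smul' _ _ := rfl

/-- The image of a code under a coordinate permutation. -/
def permCode (σ : Equiv.Perm ι) (Code : Submodule (ZMod 2) (ι → ZMod 2)) :
    Submodule (ZMod 2) (ι → ZMod 2) := Submodule.map (permLM σ) Code

/-- Two binary codes are equivalent if a coordinate permutation maps one onto the other. -/
def codeEquiv (C D : Submodule (ZMod 2) (ι → ZMod 2)) : Prop :=
  ∃ σ : Equiv.Perm ι, permCode σ C = D

/-- The code has minimum weight (exactly) `d`. -/
def minWtEq [Fintype ι] (Code : Submodule (ZMod 2) (ι → ZMod 2)) (d : ℕ) : Prop :=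
  (∀ v ∈ Code, v ≠ 0 → d ≤ wt v) ∧ ∃ v ∈ Code, v ≠ 0 ∧ wt v = d

/-- Coordinates for a length `p*c + f` code: `c` blocks of size `p` (the `p`-cycles)
together with `f` fixed points. -/
abbrev Idx (p c f : ℕ) := Fin c × Fin p ⊕ Fin f

/-- The standard automorphism of type `p-(c,f)`: a simultaneous cyclic shift in each
of the `c` blocks of length `p`, fixing the `f` fixed points. -/
def stdPerm (p c f : ℕ) [NeZero p] : Equiv.Perm (Idx p c f) :=
  Equiv.sumCongr ((Equiv.refl (Fin c)).prodCongr (Equiv.addRight (1 : Fin p))) (Equiv.refl (Fin f))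

/-- `F_σ(C)`: the subcode of codewords fixed by the standard automorphism. -/
def fixedSubcode (p c f : ℕ) [NeZero p] (Code : Submodule (ZMod 2) (Idx p c f → ZMod 2)) :
    Submodule (ZMod 2) (Idx p c f → ZMod 2) :=
  Code ⊓ LinearMap.ker (permLM (stdPerm p c f) - LinearMap.id)

/-- The linear functional summing the coordinates of a vector over the `b`-th cycle. -/
def cycleSum (p c f : ℕ) (b : Fin c) : (Idx p c f → ZMod 2) →ₗ[ZMod 2] ZMod 2 where
  toFun v := ∑ r : Fin p, v (Sum.inl (b, r))
  map_add' u v := by simp [Finset.sum_add_distrib]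
  map_smul' a v := by simp [Finset.mul_sum]

/-- `E_σ(C)`: the subcode of codewords whose restriction to every cycle and every fixed
point has even weight (over `F_2`: sums to zero). -/
def evenSubcode (p c f : ℕ) [NeZero p] (Code : Submodule (ZMod 2) (Idx p c f → ZMod 2)) :
    Submodule (ZMod 2) (Idx p c f → ZMod 2) :=
  Code ⊓ (⨅ b : Fin c, LinearMap.ker (cycleSum p c f b)) ⊓
    (⨅ k : Fin f, LinearMap.ker (LinearMap.proj (R := ZMod 2) (φ := fun _ : Idx p c f => ZMod 2) (Sum.inr k)))

/-- The projection `π : F_σ(C) → F_2^{c+f}` reading off the common value on each cycle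
and the value at each fixed point. -/
def piLM (p c f : ℕ) [NeZero p] : (Idx p c f → ZMod 2) →ₗ[ZMod 2] ((Fin c ⊕ Fin f) → ZMod 2) where
  toFun v := Sum.elim (fun b => v (Sum.inl (b, 0))) fun k => v (Sum.inr k)
  map_add' u v := by funext x; cases x <;> rfl
  map_smul' a v := by funext x; cases x <;> rfl

/-- `R_p = F_2[x]/(x^p - 1)`. -/
def Rp (p : ℕ) : Type := Polynomial (ZMod 2) ⧸ Ideal.span {(Polynomial.X : Polynomial (ZMod 2)) ^ p - 1}

noncomputable instance (p : ℕ) : CommRing (Rp p) := Ideal.Quotient.commRing _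

/-- The natural projection `F_2[x] → R_p`. -/
noncomputable def toRp (p : ℕ) (q : Polynomial (ZMod 2)) : Rp p := Ideal.Quotient.mk _ q

/-- `φ` coordinatewise: the `b`-th cycle of `v` viewed as an element of `R_p`. -/
noncomputable def phiCoord (p c f : ℕ) (v : Idx p c f → ZMod 2) (b : Fin c) : Rp p :=
  toRp p (∑ r : Fin p, Polynomial.C (v (Sum.inl (b, r))) * Polynomial.X ^ (r : ℕ))

/-- The `b`-th cycle of `v` viewed as a polynomial in `x⁻¹` (using `x⁻¹ = x^{p-1}` in `R_p`). -/
noncomputable def phiCoordInv (p c f : ℕ) (v : Idx p c f → ZMod 2) (b : Fin c) : Rp p :=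
  toRp p (∑ r : Fin p, Polynomial.C (v (Sum.inl (b, r))) * Polynomial.X ^ ((p - 1) * (r : ℕ)))

/-- `P`: the set of even-weight polynomials in `R_p`. -/
def Pset (p : ℕ) : Set (Rp p) :=
  {a | ∃ w : Fin p → ZMod 2,
    a = toRp p (∑ r : Fin p, Polynomial.C (w r) * Polynomial.X ^ (r : ℕ)) ∧ ∑ r, w r = 0}

/-- `C_φ = φ(E_σ(C)^*)` as a subset of `R_p^c`. -/
def CphiSet (p c f : ℕ) [NeZero p] (Code : Submodule (ZMod 2) (Idx p c f → ZMod 2)) :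
    Set (Fin c → Rp p) :=
  {u | ∃ v ∈ evenSubcode p c f Code, ∀ b, u b = phiCoord p c f v b}

/-- An automorphism of type `p-(c,f)` of a code of length `n`: order `p`, exactly `f`
fixed points (hence exactly `c` independent `p`-cycles, as `n = p*c + f`). -/
def autOfType {n : ℕ} (σ : Equiv.Perm (Fin n)) (p c f : ℕ) : Prop :=
  orderOf σ = p ∧ (Finset.univ.filter fun i => σ i = i).card = f ∧ n = p * c + f

/-- A self-dual code has dimension half its length. -/
lemma isSelfDual.two_mul_finrank {κ : Type*} [Fintype κ]
    {S : Submodule (ZMod 2) (κ → ZMod 2)} (hS : isSelfDual S) :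
    2 * Module.finrank (ZMod 2) S = Fintype.card κ := by
  classical
  let B : LinearMap.BilinForm (ZMod 2) (κ → ZMod 2) := dotProductBilin (ZMod 2) (ZMod 2)
  have hB : ∀ u v, B u v = ∑ i, u i * v i := fun _ _ => rfl
  have hrefl : B.IsRefl := fun u v h => by
    rw [hB] at h ⊢
    simpa only [mul_comm] using h
  have hnd : B.Nondegenerate := by
    refine (LinearMap.IsRefl.nondegenerate_iff_separatingLeft hrefl).2 fun u hu => ?_
    funext i
    simpa [hB, Pi.single_apply] using hu (Pi.single i 1)
  have hort : B.orthogonal S = S := by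
    ext u
    rw [hS u, LinearMap.BilinForm.mem_orthogonal_iff]
    refine forall₂_congr fun v _ => ?_
    rw [hB]
    simp only [mul_comm]
  have h := LinearMap.BilinForm.finrank_orthogonal hnd S
  rw [hort, Module.finrank_fintype_fun_eq_card] at h
  have hle := Submodule.finrank_le S
  rw [Module.finrank_fintype_fun_eq_card] at hle
  omega

section Decomposition

variable {p c f : ℕ}

/-- The vector that is constant on each cycle and has prescribed values `y`. -/
def liftVec (p : ℕ) (y : Fin c ⊕ Fin f → ZMod 2) : Idx p c f → ZMod 2 :=
  Sum.elim (fun x => y (Sum.inl x.1)) fun k => y (Sum.inr k)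

/-- The sum of `v` over each cycle, and its value at each fixed point. -/
def cycleSums (v : Idx p c f → ZMod 2) : Fin c ⊕ Fin f → ZMod 2 :=
  Sum.elim (fun b => ∑ r, v (Sum.inl (b, r))) fun k => v (Sum.inr k)

lemma cycleSums_liftVec (hodd : Odd p) (y : Fin c ⊕ Fin f → ZMod 2) :
    cycleSums (liftVec p y) = y := by
  funext x
  cases x <;> simp [cycleSums, liftVec, ZMod.natCast_eq_one_iff_odd.2 hodd]

lemma cycleSums_sub (u v : Idx p c f → ZMod 2) :
    cycleSums (u - v) = cycleSums u - cycleSums v := by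
  funext x
  cases x <;> simp [cycleSums]

lemma sum_liftVec_mul (y : Fin c ⊕ Fin f → ZMod 2) (v : Idx p c f → ZMod 2) :
    ∑ i, liftVec p y i * v i = ∑ j, y j * cycleSums v j := by
  simp [Fintype.sum_sum_type, Fintype.sum_prod_type, liftVec, cycleSums, Finset.mul_sum]

variable [NeZero p] {Code : Submodule (ZMod 2) (Idx p c f → ZMod 2)} {v : Idx p c f → ZMod 2}

lemma ofNat_succ_eq_add_one (p k : ℕ) [NeZero p] : Fin.ofNat p (k + 1) = Fin.ofNat p k + 1 := by
  ext
  simp [Fin.val_add]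

/-- Shifting every cycle by `s`. -/
def shiftVec (v : Idx p c f → ZMod 2) (s : Fin p) : Idx p c f → ZMod 2 :=
  Sum.elim (fun x => v (Sum.inl (x.1, x.2 + s))) fun k => v (Sum.inr k)

lemma permLM_shiftVec (v : Idx p c f → ZMod 2) (s : Fin p) :
    permLM (stdPerm p c f) (shiftVec v s) = shiftVec v (s + 1) := by
  funext x
  rcases x with ⟨b, r⟩ | k
  · simp [permLM, stdPerm, shiftVec, add_assoc, add_comm s]
  · rfl

lemma shiftVec_zero (v : Idx p c f → ZMod 2) : shiftVec v 0 = v := by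
  funext x
  rcases x with ⟨b, r⟩ | k <;> simp [shiftVec]

lemma shiftVec_mem (haut : permCode (stdPerm p c f) Code = Code) (hv : v ∈ Code) (s : Fin p) :
    shiftVec v s ∈ Code := by
  have key : ∀ k : ℕ, shiftVec v (Fin.ofNat p k) ∈ Code := by
    intro k
    induction k with
    | zero => simpa [shiftVec_zero] using hv
    | succ k ih =>
      rw [ofNat_succ_eq_add_one, ← permLM_shiftVec, ← haut]
      exact Submodule.mem_map_of_mem ih
  simpa using key s

lemma shiftVec_eq_self (hv : permLM (stdPerm p c f) v = v) (s : Fin p) : shiftVec v s = v := by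
  have key : ∀ k : ℕ, shiftVec v (Fin.ofNat p k) = v := by
    intro k
    induction k with
    | zero => simp [shiftVec_zero]
    | succ k ih => rw [ofNat_succ_eq_add_one, ← permLM_shiftVec, ih, hv]
  simpa using key s

lemma sum_shiftVec (hodd : Odd p) (v : Idx p c f → ZMod 2) :
    ∑ s, shiftVec v s = liftVec p (cycleSums v) := by
  funext x
  rw [Finset.sum_apply]
  rcases x with ⟨b, r⟩ | k
  · exact Equiv.sum_comp (Equiv.addLeft r) fun s => v (Sum.inl (b, s))
  · simp [shiftVec, liftVec, cycleSums, ZMod.natCast_eq_one_iff_odd.2 hodd]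

lemma liftVec_cycleSums_mem (hodd : Odd p) (haut : permCode (stdPerm p c f) Code = Code)
    (hv : v ∈ Code) : liftVec p (cycleSums v) ∈ Code := by
  rw [← sum_shiftVec hodd]
  exact Submodule.sum_mem _ fun s _ => shiftVec_mem haut hv s

lemma mem_fixedSubcode_iff :
    v ∈ fixedSubcode p c f Code ↔ v ∈ Code ∧ liftVec p (piLM p c f v) = v := by
  simp only [fixedSubcode, Submodule.mem_inf, LinearMap.mem_ker, LinearMap.sub_apply,
    LinearMap.id_apply, sub_eq_zero]
  refine and_congr_right fun _ => ⟨fun h => ?_, fun h => ?_⟩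
  · funext x
    rcases x with ⟨b, r⟩ | k
    · simpa [shiftVec, liftVec, piLM] using
        (congrFun (shiftVec_eq_self h r) (Sum.inl (b, 0))).symm
    · rfl
  · rw [← h]
    funext x
    rcases x with ⟨b, r⟩ | k <;> rfl

lemma mem_evenSubcode_iff :
    v ∈ evenSubcode p c f Code ↔ v ∈ Code ∧ cycleSums v = 0 := by
  simp only [evenSubcode, Submodule.mem_inf, Submodule.mem_iInf, LinearMap.mem_ker, and_assoc]
  refine and_congr_right fun _ => ?_
  rw [funext_iff, Sum.forall]
  rfl

lemma piLM_liftVec (y : Fin c ⊕ Fin f → ZMod 2) : piLM p c f (liftVec p y) = y := by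
  funext x
  cases x <;> rfl

lemma liftVec_mem_fixedSubcode {y : Fin c ⊕ Fin f → ZMod 2} (hy : liftVec p y ∈ Code) :
    liftVec p y ∈ fixedSubcode p c f Code :=
  mem_fixedSubcode_iff.2 ⟨hy, by rw [piLM_liftVec]⟩

lemma fixedSubcode_inf_evenSubcode (hodd : Odd p) :
    fixedSubcode p c f Code ⊓ evenSubcode p c f Code = ⊥ := by
  rw [Submodule.eq_bot_iff]
  intro v hv
  have hlift := (mem_fixedSubcode_iff.1 hv.1).2
  have hsum := (mem_evenSubcode_iff.1 hv.2).2
  rw [← hlift, cycleSums_liftVec hodd] at hsum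
  rw [← hlift, hsum]
  funext x
  cases x <;> rfl

lemma fixedSubcode_sup_evenSubcode (hodd : Odd p)
    (haut : permCode (stdPerm p c f) Code = Code) :
    fixedSubcode p c f Code ⊔ evenSubcode p c f Code = Code := by
  refine le_antisymm (sup_le inf_le_left (inf_le_left.trans inf_le_left)) fun v hv => ?_
  have hmem := liftVec_cycleSums_mem hodd haut hv
  refine Submodule.mem_sup.2 ⟨_, liftVec_mem_fixedSubcode hmem, v - liftVec p (cycleSums v),
    mem_evenSubcode_iff.2 ⟨Code.sub_mem hv hmem, ?_⟩, add_sub_cancel _ _⟩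
  rw [cycleSums_sub, cycleSums_liftVec hodd, sub_self]

/-- The projection of the fixed subcode of a self-dual code is self-dual. -/
lemma isSelfDual_map_piLM (hodd : Odd p) (hsd : isSelfDual Code)
    (haut : permCode (stdPerm p c f) Code = Code) :
    isSelfDual ((fixedSubcode p c f Code).map (piLM p c f)) := by
  intro y
  constructor
  · rintro ⟨u, hu, rfl⟩ z ⟨w, hw, rfl⟩
    obtain ⟨hu, hul⟩ := mem_fixedSubcode_iff.1 hu
    obtain ⟨hw, hwl⟩ := mem_fixedSubcode_iff.1 hw
    have h := (hsd u).1 hu w hw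
    rw [← hul, ← hwl, sum_liftVec_mul, cycleSums_liftVec hodd] at h
    exact h
  · intro h
    refine ⟨liftVec p y, liftVec_mem_fixedSubcode ((hsd _).2 fun v hv => ?_), piLM_liftVec y⟩
    rw [sum_liftVec_mul]
    exact h _ ⟨_, liftVec_mem_fixedSubcode (liftVec_cycleSums_mem hodd haut hv), piLM_liftVec _⟩

lemma two_mul_finrank_fixedSubcode (hodd : Odd p) (hsd : isSelfDual Code)
    (haut : permCode (stdPerm p c f) Code = Code) :
    2 * Module.finrank (ZMod 2) (fixedSubcode p c f Code) = c + f := by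
  have hinj : Set.InjOn (piLM p c f) (fixedSubcode p c f Code) := fun u hu w hw h => by
    rw [← (mem_fixedSubcode_iff.1 hu).2, ← (mem_fixedSubcode_iff.1 hw).2, h]
  have heq : Module.finrank (ZMod 2) ((fixedSubcode p c f Code).map (piLM p c f)) =
      Module.finrank (ZMod 2) (fixedSubcode p c f Code) := by
    rw [← LinearMap.range_domRestrict]
    exact LinearMap.finrank_range_of_inj (Set.injOn_iff_injective.1 hinj)
  have h := (isSelfDual_map_piLM hodd hsd haut).two_mul_finrank
  rw [heq] at h
  simpa using h

end Decomposition

/-- Huffman's decomposition theorem: a binary self-dual code `C` of length `p*c + f`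
with the standard automorphism `σ` of odd prime order `p` of type `p-(c,f)` is the
internal direct sum of `F_σ(C)` and `E_σ(C)`, which have dimensions `(c+f)/2` and
`c(p-1)/2` over `F_2` respectively. -/
theorem sd_direct_sum_fixed_even (p c f : ℕ) [NeZero p] (hp : p.Prime) (hodd : Odd p)
    (Code : Submodule (ZMod 2) (Idx p c f → ZMod 2))
    (hsd : isSelfDual Code)
    (haut : permCode (stdPerm p c f) Code = Code) :
    fixedSubcode p c f Code ⊓ evenSubcode p c f Code = ⊥ ∧
    fixedSubcode p c f Code ⊔ evenSubcode p c f Code = Code ∧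
    2 * Module.finrank (ZMod 2) (fixedSubcode p c f Code) = c + f ∧
    2 * Module.finrank (ZMod 2) (evenSubcode p c f Code) = c * (p - 1) := by
  have hinf := fixedSubcode_inf_evenSubcode (c := c) (f := f) (Code := Code) hodd
  have hsup := fixedSubcode_sup_evenSubcode hodd haut
  have hfix := two_mul_finrank_fixedSubcode hodd hsd haut
  refine ⟨hinf, hsup, hfix, ?_⟩
  have hdim := Submodule.finrank_sup_add_finrank_inf_eq
    (fixedSubcode p c f Code) (evenSubcode p c f Code)
  rw [hinf, hsup, finrank_bot, add_zero] at hdim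
  have hcode := hsd.two_mul_finrank
  simp only [Fintype.card_sum, Fintype.card_prod, Fintype.card_fin] at hcode
  obtain ⟨q, rfl⟩ := Nat.exists_eq_succ_of_ne_zero hp.ne_zero
  simp only [Nat.succ_eq_add_one, mul_add, mul_one, Nat.add_sub_cancel] at *
  omega

end SD
end

section
/- Let p be an odd prime such that 2 is a primitive root modulo p, so that the set P of even-weight polynomials in R_p = F_2[x]/⟨x^p−1⟩ is a field with 2^{p−1} elements. Let C be a binary [n, n/2] code with an automorphism σ of type p-(c,f). Then C is self-dual if and only if: (i) C_π = π(F_σ(C)) is a self-dual binary code of length c + f; and (ii) C_φ = φ(E_σ(C)*) is a self-dual code of length c over the field P under the inner product (u,v) = Σ_{i=1}^{c} u_i v_i^{q}, where q = 2^{(p−1)/2}. -/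
namespace SD

variable {ι : Type*}

/-- The fixed-point projector: each cycle is replaced by its coordinate sum, and the
fixed points are kept. -/
def cycleAvg (p c f : ℕ) : (Idx p c f → ZMod 2) →ₗ[ZMod 2] (Idx p c f → ZMod 2) where
  toFun v := Sum.elim (fun x => ∑ r : Fin p, v (Sum.inl (x.1, r))) fun k => v (Sum.inr k)
  map_add' u v := by funext x; rcases x with ⟨b, r⟩ | k <;> simp [Finset.sum_add_distrib]
  map_smul' a v := by funext x; rcases x with ⟨b, r⟩ | k <;> simp [Finset.mul_sum]

/-- Simultaneous rotation of every cycle by `s` positions. -/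
def rotate {p c f : ℕ} (s : Fin p) (v : Idx p c f → ZMod 2) : Idx p c f → ZMod 2 :=
  Sum.elim (fun x => v (Sum.inl (x.1, x.2 + s))) fun k => v (Sum.inr k)

/-- Self-duality may be tested separately on the range and on the kernel of a self-adjoint
projection that preserves the code. -/
theorem isSelfDual_iff_of_selfAdjoint_projection [Fintype ι]
    (Code : Submodule (ZMod 2) (ι → ZMod 2))
    (e : (ι → ZMod 2) →ₗ[ZMod 2] (ι → ZMod 2)) (hidem : ∀ v, e (e v) = e v)
    (hadj : ∀ u v, e u ⬝ᵥ v = u ⬝ᵥ e v) (hinv : ∀ v ∈ Code, e v ∈ Code) :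
    isSelfDual Code ↔
      (∀ w, e w = w → (w ∈ Code ↔ ∀ v ∈ Code, w ⬝ᵥ v = 0)) ∧
      (∀ w, e w = 0 → (w ∈ Code ↔ ∀ v ∈ Code, w ⬝ᵥ v = 0)) := by
  refine ⟨fun h => ⟨fun w _ => h w, fun w _ => h w⟩, fun ⟨hF, hE⟩ w => ?_⟩
  have hFw := hF (e w) (hidem w)
  have hEw := hE (w - e w) (by rw [map_sub, hidem, sub_self])
  change w ∈ Code ↔ ∀ v ∈ Code, w ⬝ᵥ v = 0
  constructor
  · intro hw v hv
    have h1 := hFw.1 (hinv w hw) v hv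
    have h2 := hEw.1 (Code.sub_mem hw (hinv w hw)) v hv
    rwa [sub_dotProduct, h1, sub_zero] at h2
  · intro hw
    have h1 : ∀ v ∈ Code, e w ⬝ᵥ v = 0 := fun v hv => by rw [hadj, hw _ (hinv v hv)]
    have h2 := hEw.2 fun v hv => by rw [sub_dotProduct, h1 v hv, hw v hv, sub_zero]
    simpa using Code.add_mem h2 (hFw.2 h1)

section Projector

variable {p c f : ℕ}

theorem natCast_eq_one_of_odd (hodd : Odd p) : (p : ZMod 2) = 1 :=
  ZMod.natCast_eq_one_iff_odd.2 hodd

theorem cycleAvg_idem (hodd : Odd p) (v : Idx p c f → ZMod 2) :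
    cycleAvg p c f (cycleAvg p c f v) = cycleAvg p c f v := by
  funext x
  rcases x with ⟨b, r⟩ | k <;> simp [cycleAvg, natCast_eq_one_of_odd hodd]

theorem cycleAvg_dotProduct (u v : Idx p c f → ZMod 2) :
    cycleAvg p c f u ⬝ᵥ v = u ⬝ᵥ cycleAvg p c f v := by
  simp only [dotProduct, Fintype.sum_sum_type, Fintype.sum_prod_type, cycleAvg, LinearMap.coe_mk,
    AddHom.coe_mk, Sum.elim_inl, Sum.elim_inr, ← Finset.mul_sum, ← Finset.sum_mul]

theorem rotate_dotProduct [NeZero p] (s : Fin p) (u v : Idx p c f → ZMod 2) :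
    rotate s u ⬝ᵥ v = u ⬝ᵥ rotate (-s) v := by
  simp only [dotProduct, Fintype.sum_sum_type, Fintype.sum_prod_type, rotate, Sum.elim_inl,
    Sum.elim_inr]
  congr 1
  refine Finset.sum_congr rfl fun b _ => ?_
  exact Fintype.sum_equiv (Equiv.addRight s) _ _ fun r => by simp

theorem cycleAvg_eq_sum_rotate [NeZero p] (hodd : Odd p) (v : Idx p c f → ZMod 2) :
    cycleAvg p c f v = ∑ s : Fin p, rotate s v := by
  funext x
  rcases x with ⟨b, r⟩ | k
  · simp only [cycleAvg, rotate, LinearMap.coe_mk, AddHom.coe_mk, Sum.elim_inl, Finset.sum_apply]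
    exact (Fintype.sum_equiv (Equiv.addLeft r) _ _ fun s => by simp).symm
  · simp [cycleAvg, rotate, natCast_eq_one_of_odd hodd]

theorem rotate_mem_of_forall_comp_mem [NeZero p] (hp : p.Prime) {S : Set (Idx p c f → ZMod 2)}
    (hS : ∀ v ∈ S, v ∘ stdPerm p c f ∈ S) {v : Idx p c f → ZMod 2} (hv : v ∈ S) (s : Fin p) :
    rotate s v ∈ S := by
  obtain ⟨k, hk⟩ := s
  induction k with
  | zero =>
    convert hv using 1
    funext x
    rcases x with ⟨b, r⟩ | k
    · have : (⟨0, hk⟩ : Fin p) = 0 := rfl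
      simp [rotate, this]
    · rfl
  | succ k ih =>
    have hk' : k < p := by omega
    convert hS _ (ih hk') using 1
    funext x
    rcases x with ⟨b, r⟩ | j
    · have h1 : (⟨k + 1, hk⟩ : Fin p) = 1 + ⟨k, hk'⟩ := by
        ext
        rw [Fin.val_add, Fin.val_one', Nat.mod_eq_of_lt hp.one_lt,
          Nat.mod_eq_of_lt (by simp only; omega)]
        simp only; omega
      simp [rotate, stdPerm, h1, add_assoc]
    · rfl

theorem comp_stdPerm_eq_iff [NeZero p] (hp : p.Prime) (hodd : Odd p) (v : Idx p c f → ZMod 2) :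
    v ∘ stdPerm p c f = v ↔ cycleAvg p c f v = v := by
  constructor
  · intro h
    have hrot : ∀ s : Fin p, rotate s v = v := fun s =>
      rotate_mem_of_forall_comp_mem hp (S := {v}) (by rintro _ rfl; exact h) rfl s
    rw [cycleAvg_eq_sum_rotate hodd]
    funext x
    simp [hrot, natCast_eq_one_of_odd hodd]
  · intro h
    rw [← h]
    funext x
    rcases x with ⟨b, r⟩ | k <;> rfl

theorem cycleAvg_eq_zero_iff [NeZero p] (v : Idx p c f → ZMod 2) :
    cycleAvg p c f v = 0 ↔ (∀ b, ∑ r : Fin p, v (Sum.inl (b, r)) = 0) ∧ ∀ k, v (Sum.inr k) = 0 := by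
  constructor
  · exact fun h => ⟨fun b => congrFun h (Sum.inl (b, 0)), fun k => congrFun h (Sum.inr k)⟩
  · rintro ⟨h1, h2⟩
    funext x
    rcases x with ⟨b, r⟩ | k
    · exact h1 b
    · exact h2 k

theorem mem_evenSubcode [NeZero p] {Code : Submodule (ZMod 2) (Idx p c f → ZMod 2)}
    {v : Idx p c f → ZMod 2} :
    v ∈ evenSubcode p c f Code ↔ v ∈ Code ∧ cycleAvg p c f v = 0 := by
  simp [evenSubcode, cycleAvg_eq_zero_iff, cycleSum, and_assoc]

theorem mem_fixedSubcode [NeZero p] (hp : p.Prime) (hodd : Odd p)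
    {Code : Submodule (ZMod 2) (Idx p c f → ZMod 2)} {v : Idx p c f → ZMod 2} :
    v ∈ fixedSubcode p c f Code ↔ v ∈ Code ∧ cycleAvg p c f v = v := by
  rw [← comp_stdPerm_eq_iff hp hodd, fixedSubcode, Submodule.mem_inf, LinearMap.mem_ker,
    LinearMap.sub_apply, sub_eq_zero]
  rfl

/-- The vector that is constant on cycles with prescribed values. -/
def constLift (p : ℕ) {c f : ℕ} (x : Fin c ⊕ Fin f → ZMod 2) : Idx p c f → ZMod 2 :=
  Sum.elim (fun y => x (Sum.inl y.1)) fun k => x (Sum.inr k)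

theorem cycleAvg_constLift (hodd : Odd p) (x : Fin c ⊕ Fin f → ZMod 2) :
    cycleAvg p c f (constLift p x) = constLift p x := by
  funext y
  rcases y with ⟨b, r⟩ | k <;> simp [cycleAvg, constLift, natCast_eq_one_of_odd hodd]

end Projector

section FixedPart

variable {p c f : ℕ} [NeZero p]

theorem piLM_constLift (x : Fin c ⊕ Fin f → ZMod 2) : piLM p c f (constLift p x) = x := by
  funext y
  rcases y with b | k <;> rfl

theorem constLift_piLM {v : Idx p c f → ZMod 2} (hv : cycleAvg p c f v = v) :
    constLift p (piLM p c f v) = v := by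
  rw [← hv]
  funext x
  rcases x with ⟨b, r⟩ | k <;> rfl

theorem constLift_dotProduct (x : Fin c ⊕ Fin f → ZMod 2) (v : Idx p c f → ZMod 2) :
    constLift p x ⬝ᵥ v = x ⬝ᵥ piLM p c f (cycleAvg p c f v) := by
  simp [dotProduct, Fintype.sum_sum_type, Fintype.sum_prod_type, cycleAvg, constLift, piLM,
    Finset.mul_sum]

theorem isSelfDual_map_piLM_iff (hp : p.Prime) (hodd : Odd p)
    {Code : Submodule (ZMod 2) (Idx p c f → ZMod 2)}
    (hinv : ∀ v ∈ Code, cycleAvg p c f v ∈ Code) :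
    isSelfDual (Submodule.map (piLM p c f) (fixedSubcode p c f Code)) ↔
      ∀ w, cycleAvg p c f w = w → (w ∈ Code ↔ ∀ v ∈ Code, w ⬝ᵥ v = 0) := by
  have hmem : ∀ x, x ∈ Submodule.map (piLM p c f) (fixedSubcode p c f Code) ↔
      constLift p x ∈ Code := by
    intro x
    rw [Submodule.mem_map]
    constructor
    · rintro ⟨v, hv, rfl⟩
      rw [mem_fixedSubcode hp hodd] at hv
      rw [constLift_piLM hv.2]
      exact hv.1
    · exact fun h => ⟨_, (mem_fixedSubcode hp hodd).2 ⟨h, cycleAvg_constLift hodd x⟩,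
        piLM_constLift x⟩
  have horth : ∀ x, (∀ y ∈ Submodule.map (piLM p c f) (fixedSubcode p c f Code), x ⬝ᵥ y = 0) ↔
      ∀ v ∈ Code, constLift p x ⬝ᵥ v = 0 := by
    intro x
    constructor
    · intro h v hv
      rw [constLift_dotProduct]
      exact h _ (Submodule.mem_map_of_mem
        ((mem_fixedSubcode hp hodd).2 ⟨hinv v hv, cycleAvg_idem hodd v⟩))
    · rintro h _ ⟨v, hv, rfl⟩
      have hv' := (mem_fixedSubcode hp hodd).1 hv
      rw [← hv'.2, ← constLift_dotProduct]
      exact h v hv'.1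
  constructor
  · intro h w hw
    have hx := ((hmem _).symm.trans (h (piLM p c f w))).trans (horth _)
    rwa [constLift_piLM hw] at hx
  · intro h x
    rw [hmem]
    exact (h _ (cycleAvg_constLift hodd x)).trans (horth x).symm

end FixedPart

section EvenPart

variable {p c f : ℕ}

/-- The polynomial with coefficient vector `w`. -/
noncomputable def coeffPoly (w : Fin p → ZMod 2) : Polynomial (ZMod 2) :=
  ∑ r : Fin p, Polynomial.C (w r) * Polynomial.X ^ (r : ℕ)

/-- The quotient map `F_2[x] → R_p` as a ring homomorphism. -/
noncomputable def toRpHom (p : ℕ) : Polynomial (ZMod 2) →+* Rp p := Ideal.Quotient.mk _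

theorem toRpHom_eq_zero_iff {g : Polynomial (ZMod 2)} :
    toRpHom p g = 0 ↔ (Polynomial.X : Polynomial (ZMod 2)) ^ p - 1 ∣ g :=
  Ideal.Quotient.eq_zero_iff_dvd _ _

theorem toRpHom_X_pow (p : ℕ) : toRpHom p Polynomial.X ^ p = 1 := by
  rw [← sub_eq_zero, ← map_pow, ← map_one (toRpHom p), ← map_sub]
  exact toRpHom_eq_zero_iff.2 dvd_rfl

theorem coeffPoly_sub (u v : Fin p → ZMod 2) :
    coeffPoly (u - v) = coeffPoly u - coeffPoly v := by
  simp [coeffPoly, sub_mul]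

theorem sum_coeffPoly {κ : Type*} (t : Finset κ) (w : κ → Fin p → ZMod 2) :
    ∑ b ∈ t, coeffPoly (w b) = coeffPoly fun s => ∑ b ∈ t, w b s := by
  simp only [coeffPoly, map_sum, Finset.sum_mul]
  exact Finset.sum_comm

theorem toRpHom_coeffPoly_eq_zero_iff [NeZero p] {w : Fin p → ZMod 2} :
    toRpHom p (coeffPoly w) = 0 ↔ w = 0 := by
  refine ⟨fun h => ?_, fun h => by simp [h, coeffPoly]⟩
  have hdeg : (Polynomial.X ^ p - 1 : Polynomial (ZMod 2)).degree = p :=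
    Polynomial.degree_X_pow_sub_C (NeZero.pos p) 1
  have h0 := Polynomial.eq_zero_of_dvd_of_degree_lt (toRpHom_eq_zero_iff.1 h)
    (by rw [hdeg]; exact Polynomial.degree_sum_fin_lt w)
  funext s
  have hs := congrArg (fun g => Polynomial.coeff g (s : ℕ)) h0
  simpa [coeffPoly, Polynomial.finsetSum_coeff, Polynomial.coeff_C_mul, Polynomial.coeff_X_pow,
    Fin.val_inj] using hs

theorem toRpHom_coeffPoly_injective [NeZero p] :
    Function.Injective fun w : Fin p → ZMod 2 => toRpHom p (coeffPoly w) := fun u v h =>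
  sub_eq_zero.1 (toRpHom_coeffPoly_eq_zero_iff.1
    (by rw [coeffPoly_sub, map_sub]; exact sub_eq_zero.2 h))

theorem coeffPoly_pow_two_pow (m : ℕ) (w : Fin p → ZMod 2) :
    coeffPoly w ^ 2 ^ m =
      ∑ r : Fin p, Polynomial.C (w r) * Polynomial.X ^ ((r : ℕ) * 2 ^ m) := by
  rw [coeffPoly, sum_pow_char_pow 2]
  refine Finset.sum_congr rfl fun r _ => ?_
  rw [mul_pow, ← Polynomial.C_pow, ZMod.pow_card_pow, ← pow_mul]

theorem dvd_two_pow_half_add_one (hp : p.Prime) (hodd : Odd p)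
    (hprim : orderOf (2 : ZMod p) = p - 1) : p ∣ 2 ^ ((p - 1) / 2) + 1 := by
  have := Fact.mk hp
  obtain ⟨k, hk⟩ := hodd
  have hk1 : (p - 1) / 2 = k := by omega
  have hk0 : k ≠ 0 := by rintro rfl; exact hp.ne_one (by omega)
  rw [hk1, ← CharP.cast_eq_zero_iff (ZMod p)]
  push_cast
  have hsq : ((2 : ZMod p) ^ k) ^ 2 = 1 := by
    rw [← pow_mul, show k * 2 = p - 1 by omega, ← hprim, pow_orderOf_eq_one]
  rcases (sq_eq_sq_iff_eq_or_eq_neg.1 (hsq.trans (one_pow 2).symm)) with h | h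
  · have := Nat.le_of_dvd (by omega) (orderOf_dvd_of_pow_eq_one h)
    omega
  · rw [h, neg_add_cancel]

theorem pow_val_add [NeZero p] {R : Type*} [Monoid R] {x : R} (hx : x ^ p = 1) (s r : Fin p) :
    x ^ ((s + r : Fin p) : ℕ) = x ^ (s : ℕ) * x ^ (r : ℕ) := by
  rw [Fin.val_add, ← pow_add, ← pow_eq_pow_mod _ hx]

/-- Multiplying by the conjugate computes all correlations of two coefficient vectors. -/
theorem map_coeffPoly_mul_pow [NeZero p] {R : Type*} [CommRing R]
    (g : Polynomial (ZMod 2) →+* R) (hx : g Polynomial.X ^ p = 1) {m : ℕ} (hm : p ∣ 2 ^ m + 1)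
    (u v : Fin p → ZMod 2) :
    g (coeffPoly u) * g (coeffPoly v) ^ 2 ^ m =
      g (coeffPoly fun s => ∑ r, u (r + s) * v r) := by
  have hinv : ∀ r : ℕ, g Polynomial.X ^ r * g Polynomial.X ^ (r * 2 ^ m) = 1 := by
    intro r
    obtain ⟨t, ht⟩ := hm
    rw [← pow_add, show r + r * 2 ^ m = p * (t * r) by rw [← mul_assoc, ← ht]; ring, pow_mul, hx,
      one_pow]
  rw [← map_pow, coeffPoly_pow_two_pow]
  simp only [coeffPoly, map_sum, map_mul, map_pow, Finset.sum_mul, Finset.mul_sum]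
  conv_rhs => rw [Finset.sum_comm]
  refine Finset.sum_congr rfl fun r _ => ?_
  refine (Fintype.sum_equiv (Equiv.addLeft r) _ _ fun s => ?_).symm
  rw [Equiv.coe_addLeft, pow_val_add hx]
  linear_combination (-(g (Polynomial.C (u (r + s))) * g (Polynomial.C (v r)) *
    g Polynomial.X ^ (s : ℕ))) * hinv r

theorem sum_phiCoord_mul_pow_eq_zero_iff [NeZero p] {m : ℕ} (hm : p ∣ 2 ^ m + 1)
    {w v : Idx p c f → ZMod 2} (hw : cycleAvg p c f w = 0) :
    ∑ b, phiCoord p c f w b * phiCoord p c f v b ^ 2 ^ m = 0 ↔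
      ∀ s : Fin p, w ⬝ᵥ rotate s v = 0 := by
  have hphi : ∀ (v : Idx p c f → ZMod 2) b,
      phiCoord p c f v b = toRpHom p (coeffPoly fun r => v (Sum.inl (b, r))) := fun _ _ => rfl
  simp only [hphi, map_coeffPoly_mul_pow _ (toRpHom_X_pow p) hm]
  rw [← map_sum, sum_coeffPoly, toRpHom_coeffPoly_eq_zero_iff, funext_iff]
  have hrot : ∀ s : Fin p, w ⬝ᵥ rotate (-s) v =
      ∑ b, ∑ r, w (Sum.inl (b, r + s)) * v (Sum.inl (b, r)) := by
    intro s
    rw [← rotate_dotProduct]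
    simp [dotProduct, Fintype.sum_sum_type, Fintype.sum_prod_type, rotate,
      ((cycleAvg_eq_zero_iff w).1 hw).2]
  simp only [← hrot, Pi.zero_apply]
  exact (Equiv.neg (Fin p)).forall_congr fun _ => Iff.rfl

theorem phiCoord_mem_CphiSet_iff [NeZero p] {Code : Submodule (ZMod 2) (Idx p c f → ZMod 2)}
    {w : Idx p c f → ZMod 2} (hw : cycleAvg p c f w = 0) :
    phiCoord p c f w ∈ CphiSet p c f Code ↔ w ∈ Code := by
  constructor
  · rintro ⟨v, hv, h⟩
    rw [mem_evenSubcode] at hv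
    convert hv.1
    funext x
    rcases x with ⟨b, r⟩ | k
    · exact congrFun (toRpHom_coeffPoly_injective (h b)) r
    · rw [((cycleAvg_eq_zero_iff w).1 hw).2, ((cycleAvg_eq_zero_iff v).1 hv.2).2]
  · exact fun h => ⟨w, mem_evenSubcode.2 ⟨h, hw⟩, fun _ => rfl⟩

theorem forall_mem_Pset_iff [NeZero p] {u : Fin c → Rp p} :
    (∀ b, u b ∈ Pset p) ↔
      ∃ w : Idx p c f → ZMod 2, cycleAvg p c f w = 0 ∧ phiCoord p c f w = u := by
  constructor
  · intro h
    choose w hw hw0 using h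
    exact ⟨Sum.elim (fun x => w x.1 x.2) 0, (cycleAvg_eq_zero_iff _).2 ⟨hw0, fun _ => rfl⟩,
      funext fun b => (hw b).symm⟩
  · rintro ⟨w, hw, rfl⟩ b
    exact ⟨fun r => w (Sum.inl (b, r)), rfl, ((cycleAvg_eq_zero_iff w).1 hw).1 b⟩

theorem CphiSet_selfDual_iff [NeZero p] (hodd : Odd p)
    {m : ℕ} (hm : p ∣ 2 ^ m + 1) {Code : Submodule (ZMod 2) (Idx p c f → ZMod 2)}
    (hrot : ∀ v ∈ Code, ∀ s : Fin p, rotate s v ∈ Code)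
    (hinv : ∀ v ∈ Code, cycleAvg p c f v ∈ Code) :
    (∀ u : Fin c → Rp p, u ∈ CphiSet p c f Code ↔
      ((∀ b, u b ∈ Pset p) ∧ ∀ v ∈ CphiSet p c f Code, ∑ b, u b * v b ^ 2 ^ m = 0)) ↔
      ∀ w, cycleAvg p c f w = 0 → (w ∈ Code ↔ ∀ v ∈ Code, w ⬝ᵥ v = 0) := by
  have horth : ∀ w, cycleAvg p c f w = 0 →
      ((∀ v ∈ CphiSet p c f Code, ∑ b, phiCoord p c f w b * v b ^ 2 ^ m = 0) ↔
        ∀ v ∈ Code, w ⬝ᵥ v = 0) := by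
    intro w hw
    constructor
    · intro h v hv
      have hv0 : cycleAvg p c f (v - cycleAvg p c f v) = 0 := by
        rw [map_sub, cycleAvg_idem hodd, sub_self]
      have hmem := (phiCoord_mem_CphiSet_iff hv0).2 (Code.sub_mem hv (hinv v hv))
      have h0 := (sum_phiCoord_mul_pow_eq_zero_iff hm hw).1 (h _ hmem) 0
      have hr : ∀ v : Idx p c f → ZMod 2, rotate 0 v = v := by
        intro v
        funext x
        rcases x with ⟨b, r⟩ | k <;> simp [rotate]
      rwa [hr, dotProduct_sub, ← cycleAvg_dotProduct, hw, zero_dotProduct, sub_zero] at h0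
    · rintro h u ⟨v, hv, hu⟩
      obtain rfl : u = phiCoord p c f v := funext hu
      exact (sum_phiCoord_mul_pow_eq_zero_iff hm hw).2 fun s =>
        h _ (hrot v (mem_evenSubcode.1 hv).1 s)
  constructor
  · intro h w hw
    rw [← phiCoord_mem_CphiSet_iff hw, h, ← horth w hw]
    exact and_iff_right (forall_mem_Pset_iff.2 ⟨w, hw, rfl⟩)
  · intro h u
    by_cases hu : ∀ b, u b ∈ Pset p
    · obtain ⟨w, hw, rfl⟩ := (forall_mem_Pset_iff (f := f)).1 hu
      rw [phiCoord_mem_CphiSet_iff hw, h w hw, ← horth w hw, and_iff_right hu]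
    · refine iff_of_false ?_ fun h' => hu h'.1
      rintro ⟨v, hv, huv⟩
      exact hu (forall_mem_Pset_iff.2 ⟨v, (mem_evenSubcode.1 hv).2, (funext huv).symm⟩)

end EvenPart

/-- When 2 is a primitive root modulo the odd prime `p` (so that `P`, the set of
even-weight polynomials in `R_p`, is a field with `2^{p-1}` elements), a binary
`[n, n/2]` code with the standard automorphism of type `p-(c,f)` is self-dual iff
(i) `C_π = π(F_σ(C))` is a self-dual binary code of length `c + f`, and
(ii) `C_φ = φ(E_σ(C)^*)` is a self-dual code of length `c` over `P` under the inner
product `(u,v) = ∑ u_i v_i^q` with `q = 2^{(p-1)/2}`. -/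
theorem sd_iff_primitive_root (p c f : ℕ) [NeZero p] (hp : p.Prime) (hodd : Odd p)
    (hprim : orderOf (2 : ZMod p) = p - 1)
    (Code : Submodule (ZMod 2) (Idx p c f → ZMod 2))
    (hdim : 2 * Module.finrank (ZMod 2) Code = p * c + f)
    (haut : permCode (stdPerm p c f) Code = Code) :
    isSelfDual Code ↔
      (isSelfDual (Submodule.map (piLM p c f) (fixedSubcode p c f Code)) ∧
       ∀ u : Fin c → Rp p,
         u ∈ CphiSet p c f Code ↔
           ((∀ b, u b ∈ Pset p) ∧
            ∀ v ∈ CphiSet p c f Code,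
              ∑ b : Fin c, u b * (v b) ^ (2 ^ ((p - 1) / 2)) = 0)) := by
  have hcomp : ∀ v ∈ Code, v ∘ stdPerm p c f ∈ Code := fun v hv =>
    haut ▸ Submodule.mem_map_of_mem (f := permLM (stdPerm p c f)) hv
  have hrot : ∀ v ∈ Code, ∀ s : Fin p, rotate s v ∈ Code := fun v hv s =>
    rotate_mem_of_forall_comp_mem hp (S := (Code : Set (Idx p c f → ZMod 2))) hcomp hv s
  have hinv : ∀ v ∈ Code, cycleAvg p c f v ∈ Code := fun v hv => by
    rw [cycleAvg_eq_sum_rotate hodd]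
    exact Code.sum_mem fun s _ => hrot v hv s
  rw [isSelfDual_map_piLM_iff hp hodd hinv,
    CphiSet_selfDual_iff hodd (dvd_two_pow_half_add_one hp hodd hprim) hrot hinv]
  exact isSelfDual_iff_of_selfAdjoint_projection Code (cycleAvg p c f) (cycleAvg_idem hodd)
    cycleAvg_dotProduct hinv

end SD
end

section
/- Let C_π be a binary self-dual code of length c + f and dimension k = (c+f)/2, with its coordinates partitioned into a set of c 'left' coordinates and f 'right' coordinates. Let B* = {u ∈ F_2^c : (u,0) ∈ C_π} (the projection to the left coordinates of the largest subcode of C_π supported on the left coordinates), D* = {w ∈ F_2^f : (0,w) ∈ C_π}, let B_E ⊆ F_2^c be the projection of C_π onto the left coordinates, and D_F ⊆ F_2^f the projection of C_π onto the right coordinates. Set k_1 = dim B*, k_2 = dim D*, k_3 = k − k_1 − k_2. Then: (i) k_3 = dim B_E − k_1 = dim D_F − k_2; (ii) k_2 = k + k_1 − c = k_1 + (f−c)/2; and (iii) B_E = (B*)^⊥ and D_F = (D*)^⊥. -/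
namespace SD

variable {ι : Type*}

/-- Embedding of the left coordinates: `u ↦ (u, 0)`. -/
def inlLM (c f : ℕ) : (Fin c → ZMod 2) →ₗ[ZMod 2] ((Fin c ⊕ Fin f) → ZMod 2) where
  toFun u := Sum.elim u 0
  map_add' u v := by funext x; cases x <;> simp
  map_smul' a v := by funext x; cases x <;> simp

/-- Embedding of the right coordinates: `w ↦ (0, w)`. -/
def inrLM (c f : ℕ) : (Fin f → ZMod 2) →ₗ[ZMod 2] ((Fin c ⊕ Fin f) → ZMod 2) where
  toFun w := Sum.elim 0 w
  map_add' u v := by funext x; cases x <;> simp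
  map_smul' a v := by funext x; cases x <;> simp

/-- `B^*`: the largest subcode of `C` supported on the left coordinates, projected there. -/
def Bstar (c f : ℕ) (Code : Submodule (ZMod 2) ((Fin c ⊕ Fin f) → ZMod 2)) :
    Submodule (ZMod 2) (Fin c → ZMod 2) := Submodule.comap (inlLM c f) Code

/-- `D^*`: the largest subcode of `C` supported on the right coordinates, projected there. -/
def Dstar (c f : ℕ) (Code : Submodule (ZMod 2) ((Fin c ⊕ Fin f) → ZMod 2)) :
    Submodule (ZMod 2) (Fin f → ZMod 2) := Submodule.comap (inrLM c f) Code

/-- `B_E`: the projection of `C` onto the left coordinates. -/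
def BE (c f : ℕ) (Code : Submodule (ZMod 2) ((Fin c ⊕ Fin f) → ZMod 2)) :
    Submodule (ZMod 2) (Fin c → ZMod 2) :=
  Submodule.map (LinearMap.funLeft (ZMod 2) (ZMod 2) (Sum.inl : Fin c → Fin c ⊕ Fin f)) Code

/-- `D_F`: the projection of `C` onto the right coordinates. -/
def DF (c f : ℕ) (Code : Submodule (ZMod 2) ((Fin c ⊕ Fin f) → ZMod 2)) :
    Submodule (ZMod 2) (Fin f → ZMod 2) :=
  Submodule.map (LinearMap.funLeft (ZMod 2) (ZMod 2) (Sum.inr : Fin f → Fin c ⊕ Fin f)) Code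

/-- The dual of a binary code, as the orthogonal complement for the standard inner product. -/
def dualCode [Fintype ι] (A : Submodule (ZMod 2) (ι → ZMod 2)) :
    Submodule (ZMod 2) (ι → ZMod 2) :=
  LinearMap.BilinForm.orthogonal (dotProductBilin (ZMod 2) (ZMod 2)) A

theorem mem_dualCode [Fintype ι] {A : Submodule (ZMod 2) (ι → ZMod 2)} {u : ι → ZMod 2} :
    u ∈ dualCode A ↔ ∀ v ∈ A, ∑ i, u i * v i = 0 :=
  forall₂_congr fun v _ => by
    rw [dotProductBilin_apply_apply, dotProduct_comm]
    rfl

theorem dotProductBilin_nondegenerate [Fintype ι] :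
    (dotProductBilin (ZMod 2) (ZMod 2) : LinearMap.BilinForm (ZMod 2) (ι → ZMod 2)).Nondegenerate :=
  ⟨fun v h => dotProduct_eq_zero v h,
    fun v h => dotProduct_eq_zero v fun w => (dotProduct_comm v w).trans (h w)⟩

theorem dualCode_dualCode [Fintype ι] (A : Submodule (ZMod 2) (ι → ZMod 2)) :
    dualCode (dualCode A) = A :=
  LinearMap.BilinForm.orthogonal_orthogonal dotProductBilin_nondegenerate
    (fun u v h => (dotProduct_comm v u).trans h) A

theorem finrank_add_finrank_dualCode [Fintype ι] (A : Submodule (ZMod 2) (ι → ZMod 2)) :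
    Module.finrank (ZMod 2) A + Module.finrank (ZMod 2) (dualCode A) = Fintype.card ι := by
  have h := LinearMap.BilinForm.finrank_orthogonal dotProductBilin_nondegenerate A
  have hle := Submodule.finrank_le A
  rw [Module.finrank_fintype_fun_eq_card] at h hle
  unfold dualCode
  lia

theorem Bstar_eq_dualCode_BE {c f : ℕ} {Code : Submodule (ZMod 2) ((Fin c ⊕ Fin f) → ZMod 2)}
    (hsd : isSelfDual Code) : Bstar c f Code = dualCode (BE c f Code) := by
  ext u
  rw [mem_dualCode, Bstar, Submodule.mem_comap, hsd]
  simp [BE, inlLM, LinearMap.funLeft_apply]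

theorem Dstar_eq_dualCode_DF {c f : ℕ} {Code : Submodule (ZMod 2) ((Fin c ⊕ Fin f) → ZMod 2)}
    (hsd : isSelfDual Code) : Dstar c f Code = dualCode (DF c f Code) := by
  ext w
  rw [mem_dualCode, Dstar, Submodule.mem_comap, hsd]
  simp [DF, inrLM, LinearMap.funLeft_apply]

theorem map_inrLM_Dstar (c f : ℕ) (Code : Submodule (ZMod 2) ((Fin c ⊕ Fin f) → ZMod 2)) :
    (Dstar c f Code).map (inrLM c f) =
      Code ⊓ LinearMap.ker
        (LinearMap.funLeft (ZMod 2) (ZMod 2) (Sum.inl : Fin c → Fin c ⊕ Fin f)) := by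
  ext x
  simp only [Submodule.mem_map, Dstar, Submodule.mem_comap, Submodule.mem_inf, LinearMap.mem_ker]
  constructor
  · rintro ⟨w, hw, rfl⟩
    exact ⟨hw, rfl⟩
  · rintro ⟨hx, h0⟩
    have hx' : inrLM c f (x ∘ Sum.inr) = x := by
      funext i
      cases i with
      | inl i => exact (congrFun h0 i).symm
      | inr i => rfl
    exact ⟨x ∘ Sum.inr, hx'.symm ▸ hx, hx'⟩

theorem finrank_BE_add_finrank_Dstar (c f : ℕ)
    (Code : Submodule (ZMod 2) ((Fin c ⊕ Fin f) → ZMod 2)) :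
    Module.finrank (ZMod 2) (BE c f Code) + Module.finrank (ZMod 2) (Dstar c f Code) =
      Module.finrank (ZMod 2) Code := by
  have hinj : Function.Injective (inrLM c f) := fun u v h =>
    funext fun i => congrFun h (Sum.inr i)
  have h := LinearMap.finrank_range_add_finrank_ker
    ((LinearMap.funLeft (ZMod 2) (ZMod 2) (Sum.inl : Fin c → Fin c ⊕ Fin f)).domRestrict Code)
  rw [LinearMap.range_domRestrict, LinearMap.ker_domRestrict,
    ← Submodule.finrank_map_subtype_eq, Submodule.map_comap_subtype, ← map_inrLM_Dstar,
    ← (Submodule.equivMapOfInjective _ hinj _).finrank_eq] at h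
  exact h

/-- Structure of a binary self-dual code `C_π` of length `c + f` and dimension
`k = (c+f)/2` with coordinates split into `c` left and `f` right coordinates.
With `k₁ = dim B^*`, `k₂ = dim D^*` and `k₃ = k - k₁ - k₂`:
(i) `k₃ = dim B_E − k₁ = dim D_F − k₂`;
(ii) `k₂ = k + k₁ − c = k₁ + (f − c)/2`;
(iii) `B_E = (B^*)^⊥` and `D_F = (D^*)^⊥`. -/
theorem sd_pi_structure (c f : ℕ) (Code : Submodule (ZMod 2) ((Fin c ⊕ Fin f) → ZMod 2))
    (hsd : isSelfDual Code) :
    ∀ k k₁ k₂ : ℕ,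
      k = Module.finrank (ZMod 2) Code →
      k₁ = Module.finrank (ZMod 2) (Bstar c f Code) →
      k₂ = Module.finrank (ZMod 2) (Dstar c f Code) →
      2 * k = c + f →
      (((k : ℤ) - k₁ - k₂ = (Module.finrank (ZMod 2) (BE c f Code) : ℤ) - k₁) ∧
       ((k : ℤ) - k₁ - k₂ = (Module.finrank (ZMod 2) (DF c f Code) : ℤ) - k₂)) ∧
      (((k₂ : ℤ) = (k : ℤ) + k₁ - c) ∧ (2 * (k₂ : ℤ) = 2 * (k₁ : ℤ) + (f : ℤ) - c)) ∧
      ((∀ u : Fin c → ZMod 2,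
          u ∈ BE c f Code ↔ ∀ v ∈ Bstar c f Code, ∑ b, u b * v b = 0) ∧
       (∀ w : Fin f → ZMod 2,
          w ∈ DF c f Code ↔ ∀ v ∈ Dstar c f Code, ∑ k', w k' * v k' = 0)) := by
  rintro k k₁ k₂ rfl rfl rfl hk
  have hB := finrank_add_finrank_dualCode (BE c f Code)
  have hD := finrank_add_finrank_dualCode (DF c f Code)
  rw [← Bstar_eq_dualCode_BE hsd, Fintype.card_fin] at hB
  rw [← Dstar_eq_dualCode_DF hsd, Fintype.card_fin] at hD
  have hr := finrank_BE_add_finrank_Dstar c f Code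
  refine ⟨⟨by lia, by lia⟩, ⟨by lia, by lia⟩, fun u => ?_, fun w => ?_⟩
  · rw [← mem_dualCode, Bstar_eq_dualCode_BE hsd, dualCode_dualCode]
  · rw [← mem_dualCode, Dstar_eq_dualCode_DF hsd, dualCode_dualCode]

end SD
end

section
/- Let C be a binary self-dual code of length n with an automorphism σ of odd prime order p of type p-(c,f), with cycles Ω_1,…,Ω_c and fixed points Ω_{c+1},…,Ω_{c+f}. Then each of the following coordinate transformations sends C to an equivalent code which again has σ as an automorphism (i.e., preserves the decomposition): (i) any permutation of the f fixed coordinates; (ii) any permutation of the c cycles (permuting the p-element blocks Ω_1,…,Ω_c among themselves, preserving the cyclic order within each block); (iii) the substitution x → x^2, i.e., the permutation sending position j of each cycle to position 2j mod p; and (iv) an independent cyclic shift applied to each cycle. -/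
namespace SD

variable {ι : Type*}

/-- `τ` preserves the decomposition and sends `C` to an equivalent code: the
transformed code `τ(C)` still admits the standard automorphism `σ` and is
equivalent to `C`. -/
def preservesDecomp (p c f : ℕ) [NeZero p]
    (Code : Submodule (ZMod 2) (Idx p c f → ZMod 2)) (τ : Equiv.Perm (Idx p c f)) : Prop :=
  permCode (stdPerm p c f) (permCode τ Code) = permCode τ Code ∧
  codeEquiv Code (permCode τ Code)

theorem permCode_permCode (σ τ : Equiv.Perm ι) (Code : Submodule (ZMod 2) (ι → ZMod 2)) :
    permCode σ (permCode τ Code) = permCode (τ * σ) Code := by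
  unfold permCode
  rw [← Submodule.map_comp]
  rfl

/-- If `τ` intertwines the standard automorphism with a power of itself, then it preserves the
decomposition of every code invariant under the standard automorphism. -/
theorem preservesDecomp_of_mul_eq_pow_mul (p c f : ℕ) [NeZero p]
    (Code : Submodule (ZMod 2) (Idx p c f → ZMod 2))
    (haut : permCode (stdPerm p c f) Code = Code) (τ : Equiv.Perm (Idx p c f)) (k : ℕ)
    (h : τ * stdPerm p c f = stdPerm p c f ^ k * τ) : preservesDecomp p c f Code τ := by
  refine ⟨?_, τ, rfl⟩
  have hpow : permCode (stdPerm p c f ^ k) Code = Code := by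
    clear h
    induction k with
    | zero => exact Submodule.map_id Code
    | succ k ih => rw [pow_succ', ← permCode_permCode, haut, ih]
  rw [permCode_permCode, h, ← permCode_permCode, hpow]

/-- The following transformations preserve the decomposition and send a binary
self-dual code `C` with the standard automorphism `σ` of type `p-(c,f)` to an
equivalent code:
(i) any permutation of the `f` fixed coordinates;
(ii) any permutation of the `c` cycles (blocks);
(iii) the substitution `x → x²` (position `r ↦ 2r mod p` in each cycle);
(iv) independent cyclic shifts in the cycles. -/
theorem decomposition_preserving_transformations (p c f : ℕ) [NeZero p]
    (hp : p.Prime) (hodd : Odd p)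
    (Code : Submodule (ZMod 2) (Idx p c f → ZMod 2))
    (hsd : isSelfDual Code)
    (haut : permCode (stdPerm p c f) Code = Code) :
    (∀ ρ : Equiv.Perm (Fin f),
      preservesDecomp p c f Code (Equiv.sumCongr (Equiv.refl (Fin c × Fin p)) ρ)) ∧
    (∀ μ : Equiv.Perm (Fin c),
      preservesDecomp p c f Code
        (Equiv.sumCongr (μ.prodCongr (Equiv.refl (Fin p))) (Equiv.refl (Fin f)))) ∧
    (∀ τ : Equiv.Perm (Idx p c f),
      (∀ (b : Fin c) (r : Fin p), τ (Sum.inl (b, r)) = Sum.inl (b, r + r)) →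
      (∀ k : Fin f, τ (Sum.inr k) = Sum.inr k) →
      preservesDecomp p c f Code τ) ∧
    (∀ t : Fin c → Fin p,
      preservesDecomp p c f Code
        (Equiv.sumCongr (Equiv.prodShear (Equiv.refl (Fin c)) fun b => Equiv.addRight (t b))
          (Equiv.refl (Fin f)))) := by
  refine ⟨fun ρ => ?_, fun μ => ?_, fun τ hcyc hfix => ?_, fun t => ?_⟩
  · refine preservesDecomp_of_mul_eq_pow_mul p c f Code haut _ 1 ?_
    ext (⟨b, r⟩ | k) <;> simp [stdPerm]
  · refine preservesDecomp_of_mul_eq_pow_mul p c f Code haut _ 1 ?_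
    ext (⟨b, r⟩ | k) <;> simp [stdPerm]
  · refine preservesDecomp_of_mul_eq_pow_mul p c f Code haut _ 2 ?_
    refine Equiv.ext ?_
    rintro (⟨b, r⟩ | k)
    · simp [stdPerm, hcyc, pow_two, add_assoc, add_left_comm]
    · simp [stdPerm, hfix, pow_two]
  · refine preservesDecomp_of_mul_eq_pow_mul p c f Code haut _ 1 ?_
    refine Equiv.ext ?_
    rintro (⟨b, r⟩ | k)
    · simp [stdPerm, add_right_comm]
    · simp [stdPerm]

end SD
end

section
/- Let C be a binary self-dual [44,22,8] code with an automorphism σ of type 3-(10,14), with 3-cycles Ω_1,…,Ω_{10} and fixed points Ω_{11},…,Ω_{24}, and let C_π = π(F_σ(C)) ⊆ F_2^{24} be the projection of the fixed subcode. Then every codeword of C_π of weight 4 has at most two nonzero coordinates among the 14 fixed-point coordinates (positions 11 through 24). -/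
namespace SD

variable {ι : Type*}

/-- The weight on a disjoint union of index types splits as a sum. -/
theorem wt_sum {α β : Type*} [Fintype α] [Fintype β] (v : α ⊕ β → ZMod 2) :
    wt v = wt (fun a => v (Sum.inl a)) + wt (fun b => v (Sum.inr b)) := by
  simp only [wt, Finset.card_filter, Fintype.sum_sum_type]

/-- The weight of a vector that is constant on blocks of size `p`. -/
theorem wt_comp_fst {c p : ℕ} (u : Fin c → ZMod 2) :
    wt (fun x : Fin c × Fin p => u x.1) = p * wt u := by
  simp only [wt, Finset.card_filter, Fintype.sum_prod_type, Finset.mul_sum]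
  refine Finset.sum_congr rfl fun b _ => ?_
  by_cases h : u b = 0 <;> simp [h]

/-- A vector fixed by the standard automorphism is constant on every cycle. -/
theorem eq_zero_coord_of_fixed {p c f : ℕ} [NeZero p] {v : Idx p c f → ZMod 2}
    (hv : v ∈ LinearMap.ker (permLM (stdPerm p c f) - LinearMap.id)) (b : Fin c) (r : Fin p) :
    v (Sum.inl (b, r)) = v (Sum.inl (b, 0)) := by
  have hfix : permLM (stdPerm p c f) v = v := by
    simpa [LinearMap.mem_ker, sub_eq_zero] using hv
  have hstep (s : Fin p) : v (Sum.inl (b, s + 1)) = v (Sum.inl (b, s)) :=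
    congrFun hfix (Sum.inl (b, s))
  have hcast (n : ℕ) : v (Sum.inl (b, Fin.ofNat p n)) = v (Sum.inl (b, 0)) := by
    induction n with
    | zero => rfl
    | succ n ih =>
      rw [← ih, ← hstep (Fin.ofNat p n)]
      congr 3
      ext
      simp [Fin.val_add, Fin.ofNat]
  simpa using hcast r

/-- The weight of a fixed vector in terms of its projection. -/
theorem wt_of_fixed {p c f : ℕ} [NeZero p] {v : Idx p c f → ZMod 2}
    (hv : v ∈ LinearMap.ker (permLM (stdPerm p c f) - LinearMap.id)) :
    wt v = p * wt (fun b => piLM p c f v (Sum.inl b)) +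
      wt (fun k => piLM p c f v (Sum.inr k)) := by
  rw [wt_sum, ← wt_comp_fst]
  congr 2
  funext x
  exact eq_zero_coord_of_fixed hv x.1 x.2

/-- For a binary self-dual [44,22,8] code with the standard automorphism of type
3-(10,14), every weight-4 codeword of `C_π = π(F_σ(C)) ⊆ F_2^{24}` has at most two
nonzero coordinates among the 14 fixed-point coordinates. -/
theorem sd44_type3_10_14_pi_weight4 (Code : Submodule (ZMod 2) (Idx 3 10 14 → ZMod 2))
    (hsd : isSelfDual Code)
    (hdim : Module.finrank (ZMod 2) Code = 22)
    (hmin : minWtEq Code 8)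
    (haut : permCode (stdPerm 3 10 14) Code = Code) :
    ∀ w ∈ Submodule.map (piLM 3 10 14) (fixedSubcode 3 10 14 Code),
      wt w = 4 →
      (Finset.univ.filter fun k : Fin 14 => w (Sum.inr k) ≠ 0).card ≤ 2 := by
  rintro w ⟨v, ⟨hvC, hvfix⟩, rfl⟩ hw
  have hv0 : v ≠ 0 := by
    rintro rfl
    simp [wt] at hw
  have h8 := hmin.1 v hvC hv0
  rw [wt_of_fixed hvfix] at h8
  rw [wt_sum] at hw
  change wt (fun k => piLM 3 10 14 v (Sum.inr k)) ≤ 2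
  omega

end SD
end
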